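/- arXiv:2402.08223 — 6 statements merged into one kernel-verified Lean document; each statement's English description precedes it below -/
import Mathlib

section
/- The set S' equals the image of the polytope P under the linear map L : ℝ^{K×K} → ℝ² given by L(z) := ( Σ_{i=1}^{K−1} Σ_{j=i+1}^{K} (v_j − v_{j−1})·z(i,j), Σ_{i=1}^{K} v_i·z(i,i) ), where P is the convex polytope of all z ∈ ℝ^{K×K} satisfying: (a) z(i,1) ≥ z(i,2) ≥ ... ≥ z(i,K) ≥ 0 for all i; (b) z(i,i)·v_i − z(i,j)·v_j ≥ (β/(K·(1−β)))·z(i,1)·((K+1−j)·v_j − (K+1−i)·v_i) for all i, j; (c) Σ_{i=1}^K z(i,j) = Σ_{k=j}^K x*_k for all j. -/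
/-- The set of markets: the standard simplex on value indices `1, …, K`. -/
def simplex (K : ℕ) : Set (ℕ → ℝ) :=
  {x | (∀ k ∈ Finset.Icc 1 K, 0 ≤ x k) ∧ ∑ k ∈ Finset.Icc 1 K, x k = 1}

/-- Producer utility `U_p(v_i, x) = v_i · Σ_{k=i}^K x_k`. -/
noncomputable def Up (K : ℕ) (v : ℕ → ℝ) (i : ℕ) (x : ℕ → ℝ) : ℝ :=
  v i * ∑ k ∈ Finset.Icc i K, x k

/-- Consumer utility `U_c(v_i, x) = Σ_{k=i}^K x_k · (v_k − v_i)`. -/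
noncomputable def Uc (K : ℕ) (v : ℕ → ℝ) (i : ℕ) (x : ℕ → ℝ) : ℝ :=
  ∑ k ∈ Finset.Icc i K, x k * (v k - v i)

/-- `X_i^β`: the set of markets for which `v_i` is an optimal price under the
privacy mechanism with parameter `β`. -/
def Xopt (K : ℕ) (v : ℕ → ℝ) (β : ℝ) (i : ℕ) : Set (ℕ → ℝ) :=
  {x | x ∈ simplex K ∧ ∀ j ∈ Finset.Icc 1 K,
    v i * ((1 - β) * ∑ k ∈ Finset.Icc i K, x k + β * ((K : ℝ) + 1 - i) / K) ≥
      v j * ((1 - β) * ∑ k ∈ Finset.Icc j K, x k + β * ((K : ℝ) + 1 - j) / K)}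

/-- The set `S'` of consumer/producer utility pairs achievable by segmentations in
which, for each value `v_k`, at most one segment is priced at `v_k`. -/
def Sprime (K : ℕ) (v : ℕ → ℝ) (β : ℝ) (xstar : ℕ → ℝ) : Set (ℝ × ℝ) :=
  {p | ∃ (γ : ℕ → ℝ) (xs : ℕ → ℕ → ℝ),
    (∀ k ∈ Finset.Icc 1 K, 0 ≤ γ k) ∧
    (∑ k ∈ Finset.Icc 1 K, γ k) = 1 ∧
    (∀ k ∈ Finset.Icc 1 K, xs k ∈ simplex K) ∧
    (∀ k ∈ Finset.Icc 1 K, 0 < γ k → xs k ∈ Xopt K v β k) ∧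
    (∀ j ∈ Finset.Icc 1 K, ∑ k ∈ Finset.Icc 1 K, γ k * xs k j = xstar j) ∧
    p = (∑ k ∈ Finset.Icc 1 K, γ k * Uc K v k (xs k),
         ∑ k ∈ Finset.Icc 1 K, γ k * Up K v k (xs k))}

/-- The convex polytope `P ⊆ ℝ^{K×K}` of Theorem 2. -/
def Ptope (K : ℕ) (v : ℕ → ℝ) (β : ℝ) (xstar : ℕ → ℝ) : Set (ℕ → ℕ → ℝ) :=
  {z | (∀ i ∈ Finset.Icc 1 K,
          (∀ j ∈ Finset.Icc 1 (K - 1), z i (j + 1) ≤ z i j) ∧ 0 ≤ z i K) ∧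
       (∀ i ∈ Finset.Icc 1 K, ∀ j ∈ Finset.Icc 1 K,
          z i i * v i - z i j * v j ≥
            β / (K * (1 - β)) * z i 1 *
              (((K : ℝ) + 1 - j) * v j - ((K : ℝ) + 1 - i) * v i)) ∧
       (∀ j ∈ Finset.Icc 1 K,
          ∑ i ∈ Finset.Icc 1 K, z i j = ∑ k ∈ Finset.Icc j K, xstar k)}

lemma sum_Icc_eq_add_succ {j K : ℕ} (h : j ≤ K) (f : ℕ → ℝ) :
    ∑ k ∈ Finset.Icc j K, f k = f j + ∑ k ∈ Finset.Icc (j + 1) K, f k := by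
  rw [← Finset.insert_Icc_add_one_left_eq_Icc h, Finset.sum_insert (by simp)]

/-- The market mass at `k` recovered from its tail sums `z`. -/
def tailDiff (K : ℕ) (z : ℕ → ℝ) (k : ℕ) : ℝ := z k - if k = K then 0 else z (k + 1)

lemma sum_tailDiff (K : ℕ) (z : ℕ → ℝ) {j : ℕ} (h : j ≤ K) :
    ∑ k ∈ Finset.Icc j K, tailDiff K z k = z j := by
  induction h using Nat.decreasingInduction with
  | self => simp [tailDiff]
  | of_succ k hk ih =>
    rw [sum_Icc_eq_add_succ (by omega), ih, tailDiff, if_neg (by omega)]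
    ring

lemma Uc_eq_sum_tail (K : ℕ) (v x : ℕ → ℝ) {i : ℕ} (h : i ≤ K) :
    Uc K v i x =
      ∑ j ∈ Finset.Icc (i + 1) K, (v j - v (j - 1)) * ∑ k ∈ Finset.Icc j K, x k := by
  unfold Uc
  induction h using Nat.decreasingInduction with
  | self => simp
  | of_succ i hi ih =>
    rw [sum_Icc_eq_add_succ (j := i + 1) (by omega)
        (fun j => (v j - v (j - 1)) * ∑ k ∈ Finset.Icc j K, x k), ← ih,
      sum_Icc_eq_add_succ (by omega), Finset.mul_sum, ← Finset.sum_add_distrib, sub_self,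
      mul_zero, zero_add]
    refine Finset.sum_congr rfl fun k _ => ?_
    rw [Nat.add_sub_cancel]
    ring

lemma utilities_eq_of_tail {K : ℕ} (hK : 1 ≤ K) (v γ : ℕ → ℝ) (xs z : ℕ → ℕ → ℝ)
    (hz : ∀ i ∈ Finset.Icc 1 K, ∀ j ∈ Finset.Icc 1 K,
      z i j = γ i * ∑ k ∈ Finset.Icc j K, xs i k) :
    ((∑ i ∈ Finset.Icc 1 (K - 1), ∑ j ∈ Finset.Icc (i + 1) K, (v j - v (j - 1)) * z i j,
        ∑ i ∈ Finset.Icc 1 K, v i * z i i) : ℝ × ℝ) =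
      (∑ k ∈ Finset.Icc 1 K, γ k * Uc K v k (xs k),
        ∑ k ∈ Finset.Icc 1 K, γ k * Up K v k (xs k)) := by
  refine congrArg₂ Prod.mk ?_ ?_
  · have hsub : Finset.Icc 1 (K - 1) ⊆ Finset.Icc 1 K := Finset.Icc_subset_Icc_right (by omega)
    have hlast : ∀ i ∈ Finset.Icc 1 K, i ∉ Finset.Icc 1 (K - 1) → γ i * Uc K v i (xs i) = 0 := by
      intro i hi hi'
      obtain rfl : i = K := by simp only [Finset.mem_Icc] at hi hi'; omega
      simp [Uc]
    rw [← Finset.sum_subset hsub hlast]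
    refine Finset.sum_congr rfl fun i hi => ?_
    rw [Uc_eq_sum_tail K v _ (Finset.mem_Icc.1 (hsub hi)).2, Finset.mul_sum]
    refine Finset.sum_congr rfl fun j hj => ?_
    rw [hz i (hsub hi) j (by simp only [Finset.mem_Icc] at hj ⊢; omega)]
    ring
  · refine Finset.sum_congr rfl fun i hi => ?_
    rw [hz i hi i hi, Up]
    ring

lemma price_optimal_iff {K β : ℝ} (hK : 0 < K) (hβ : β < 1) (a b s t c d : ℝ) :
    a * ((1 - β) * s + β * c / K) ≥ b * ((1 - β) * t + β * d / K) ↔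
      s * a - t * b ≥ β / (K * (1 - β)) * (d * b - c * a) := by
  have hb : 0 < 1 - β := by linarith
  have key : a * ((1 - β) * s + β * c / K) - b * ((1 - β) * t + β * d / K) =
      (1 - β) * (s * a - t * b - β / (K * (1 - β)) * (d * b - c * a)) := by
    field_simp
    ring
  rw [ge_iff_le, ge_iff_le, ← sub_nonneg, key, mul_nonneg_iff_of_pos_left hb, sub_nonneg]

lemma mem_Ptope_of_segmentation {K : ℕ} (hK : 1 ≤ K) {v xstar γ : ℕ → ℝ} {β : ℝ}
    (hβ : β < 1) {xs : ℕ → ℕ → ℝ}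
    (hγ : ∀ k ∈ Finset.Icc 1 K, 0 ≤ γ k)
    (hxs : ∀ k ∈ Finset.Icc 1 K, xs k ∈ simplex K)
    (hopt : ∀ k ∈ Finset.Icc 1 K, 0 < γ k → xs k ∈ Xopt K v β k)
    (hagg : ∀ j ∈ Finset.Icc 1 K, ∑ k ∈ Finset.Icc 1 K, γ k * xs k j = xstar j) :
    (fun i j => γ i * ∑ k ∈ Finset.Icc j K, xs i k) ∈ Ptope K v β xstar := by
  refine ⟨fun i hi => ⟨fun j hj => ?_, ?_⟩, fun i hi j hj => ?_, fun j hj => ?_⟩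
  · have hj' := Finset.mem_Icc.1 hj
    refine mul_le_mul_of_nonneg_left ?_ (hγ i hi)
    rw [sum_Icc_eq_add_succ (j := j) (by omega)]
    linarith [(hxs i hi).1 j (Finset.mem_Icc.2 (by omega))]
  · refine mul_nonneg (hγ i hi) ?_
    simpa using (hxs i hi).1 K (by simpa using hK)
  · rcases (hγ i hi).eq_or_lt with h0 | hpos
    · simp [← h0]
    · have h := (price_optimal_iff (by exact_mod_cast hK) hβ _ _ _ _ _ _).1
        ((hopt i hi hpos).2 j hj)
      have h' := mul_le_mul_of_nonneg_left h hpos.le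
      simp only [(hxs i hi).2]
      linarith
  · simp only [Finset.mul_sum]
    rw [Finset.sum_comm]
    refine Finset.sum_congr rfl fun k hk => hagg k ?_
    simp only [Finset.mem_Icc] at hj hk ⊢
    omega

lemma tailDiff_nonneg_of_mem_Ptope {K : ℕ} {v xstar : ℕ → ℝ} {β : ℝ} {z : ℕ → ℕ → ℝ}
    (hz : z ∈ Ptope K v β xstar) {i k : ℕ} (hi : i ∈ Finset.Icc 1 K)
    (hk : k ∈ Finset.Icc 1 K) : 0 ≤ tailDiff K (z i) k := by
  unfold tailDiff
  split_ifs with h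
  · subst h
    simpa using (hz.1 i hi).2
  · have hk' := Finset.mem_Icc.1 hk
    linarith [(hz.1 i hi).1 k (Finset.mem_Icc.2 (by omega))]

lemma exists_segmentation_of_mem_Ptope {K : ℕ} (hK : 1 ≤ K) {v xstar : ℕ → ℝ} {β : ℝ}
    (hβ : β < 1) (hxstar : xstar ∈ simplex K) {z : ℕ → ℕ → ℝ} (hz : z ∈ Ptope K v β xstar) :
    ∃ xs : ℕ → ℕ → ℝ,
      (∀ i ∈ Finset.Icc 1 K, xs i ∈ simplex K) ∧
      (∀ i ∈ Finset.Icc 1 K, 0 < z i 1 → xs i ∈ Xopt K v β i) ∧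
      (∀ j ∈ Finset.Icc 1 K, ∑ i ∈ Finset.Icc 1 K, z i 1 * xs i j = xstar j) ∧
      ∀ i ∈ Finset.Icc 1 K, ∀ j ∈ Finset.Icc 1 K,
        z i j = z i 1 * ∑ k ∈ Finset.Icc j K, xs i k := by
  have hnn {i k : ℕ} (hi : i ∈ Finset.Icc 1 K) (hk : k ∈ Finset.Icc 1 K) :
      0 ≤ tailDiff K (z i) k := tailDiff_nonneg_of_mem_Ptope hz hi hk
  have hz1 {i : ℕ} (hi : i ∈ Finset.Icc 1 K) : 0 ≤ z i 1 := by
    rw [← sum_tailDiff K (z i) hK]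
    exact Finset.sum_nonneg fun k hk => hnn hi hk
  set xs : ℕ → ℕ → ℝ := fun i k => if z i 1 = 0 then xstar k else tailDiff K (z i) k / z i 1
    with hxs_def
  have hmul {i k : ℕ} (hi : i ∈ Finset.Icc 1 K) (hk : k ∈ Finset.Icc 1 K) :
      z i 1 * xs i k = tailDiff K (z i) k := by
    by_cases h0 : z i 1 = 0
    · have hsum := sum_tailDiff K (z i) hK
      rw [h0] at hsum
      rw [h0, zero_mul, (Finset.sum_eq_zero_iff_of_nonneg fun k hk => hnn hi hk).1 hsum k hk]
    · simp only [hxs_def, if_neg h0]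
      field_simp
  have htail {i j : ℕ} (hi : i ∈ Finset.Icc 1 K) (hj : j ∈ Finset.Icc 1 K) :
      z i j = z i 1 * ∑ k ∈ Finset.Icc j K, xs i k := by
    have hj' := Finset.mem_Icc.1 hj
    rw [← sum_tailDiff K (z i) hj'.2, Finset.mul_sum]
    exact Finset.sum_congr rfl fun k hk =>
      (hmul hi (Finset.Icc_subset_Icc_left hj'.1 hk)).symm
  have hsimplex {i : ℕ} (hi : i ∈ Finset.Icc 1 K) : xs i ∈ simplex K := by
    by_cases h0 : z i 1 = 0
    · have : xs i = xstar := by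
        ext k
        simp [hxs_def, h0]
      rwa [this]
    · refine ⟨fun k hk => ?_, ?_⟩
      · simp only [hxs_def, if_neg h0]
        exact div_nonneg (hnn hi hk) (hz1 hi)
      · exact mul_left_cancel₀ h0 (by rw [← htail hi (by simpa using hK), mul_one])
  refine ⟨xs, fun i hi => hsimplex hi, fun i hi hpos => ⟨hsimplex hi, fun j hj => ?_⟩,
    fun j hj => ?_, fun i hi j hj => htail hi hj⟩
  · refine (price_optimal_iff (by exact_mod_cast hK) hβ _ _ _ _ _ _).2 ?_
    have h := hz.2.1 i hi j hj
    rw [htail hi hi, htail hi hj] at h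
    refine le_of_mul_le_mul_left ?_ hpos
    linarith
  · have hj' := Finset.mem_Icc.1 hj
    rw [Finset.sum_congr rfl fun i hi => hmul hi hj]
    simp only [tailDiff, Finset.sum_sub_distrib]
    rw [hz.2.2 j hj, sum_Icc_eq_add_succ hj'.2]
    split_ifs with h
    · simp [h]
    · rw [hz.2.2 (j + 1) (Finset.mem_Icc.2 (by omega))]
      ring

/-- Theorem 2: `S'` is the image of the polytope `P` under the linear
map `z ↦ (Σ_{i<j} (v_j − v_{j−1})·z(i,j), Σ_i v_i·z(i,i))`. -/
theorem stmt_12 (K : ℕ) (hK : 1 ≤ K) (v xstar : ℕ → ℝ)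
    (hv : ∀ k ∈ Finset.Icc 1 K, 0 < v k)
    (hmono : ∀ j ∈ Finset.Icc 1 K, ∀ k ∈ Finset.Icc 1 K, j < k → v j < v k)
    (β : ℝ) (hβ0 : 0 ≤ β) (hβ1 : β < 1)
    (hxstar : xstar ∈ simplex K) :
    Sprime K v β xstar
      = (fun z : ℕ → ℕ → ℝ =>
          ((∑ i ∈ Finset.Icc 1 (K - 1), ∑ j ∈ Finset.Icc (i + 1) K,
              (v j - v (j - 1)) * z i j,
            ∑ i ∈ Finset.Icc 1 K, v i * z i i) : ℝ × ℝ)) '' Ptope K v β xstar := by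
  ext p
  constructor
  · rintro ⟨γ, xs, hγ, -, hxs, hopt, hagg, rfl⟩
    exact ⟨_, mem_Ptope_of_segmentation hK hβ1 hγ hxs hopt hagg,
      utilities_eq_of_tail hK v γ xs _ fun _ _ _ _ => rfl⟩
  · rintro ⟨z, hz, rfl⟩
    obtain ⟨xs, hxs, hopt, hagg, htail⟩ := exists_segmentation_of_mem_Ptope hK hβ1 hxstar hz
    have h1 : 1 ∈ Finset.Icc 1 K := by simpa using hK
    refine ⟨fun i => z i 1, xs, fun i hi => ?_, ?_, hxs, hopt, hagg,
      utilities_eq_of_tail hK v _ xs z htail⟩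
    · change 0 ≤ z i 1
      rw [← sum_tailDiff K (z i) hK]
      exact Finset.sum_nonneg fun k hk => tailDiff_nonneg_of_mem_Ptope hz hi hk
    · rw [hz.2.2 1 h1, hxstar.2]
end

section
/- The set S' is convex, and every point (c, p) ∈ S' satisfies c ≥ 0 and c + p ≤ Σ_{k=1}^K x*_k·v_k (i.e., S' lies to the right of the vertical axis and weakly below the line on which the total surplus equals the maximum possible surplus). -/
theorem convex_simplex (K : ℕ) : Convex ℝ (simplex K) := by
  rintro x ⟨hx0, hx1⟩ y ⟨hy0, hy1⟩ a b ha hb hab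
  refine ⟨fun k hk => ?_, ?_⟩
  · have hx := hx0 k hk
    have hy := hy0 k hk
    simp only [Pi.add_apply, Pi.smul_apply, smul_eq_mul]
    positivity
  · simp only [Pi.add_apply, Pi.smul_apply, smul_eq_mul, Finset.sum_add_distrib,
      ← Finset.mul_sum, hx1, hy1, mul_one, hab]

theorem convex_Xopt (K : ℕ) (v : ℕ → ℝ) (β : ℝ) (i : ℕ) : Convex ℝ (Xopt K v β i) := by
  rintro x ⟨hx, hxi⟩ y ⟨hy, hyi⟩ a b ha hb hab
  refine ⟨convex_simplex K hx hy ha hb hab, fun j hj => ?_⟩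
  have h := add_le_add (mul_le_mul_of_nonneg_left (hxi j hj) ha)
    (mul_le_mul_of_nonneg_left (hyi j hj) hb)
  simp only [Pi.add_apply, Pi.smul_apply, smul_eq_mul, Finset.sum_add_distrib, ← Finset.mul_sum]
  obtain rfl : b = 1 - a := by linarith
  linarith

theorem Up_add (K : ℕ) (v : ℕ → ℝ) (i : ℕ) (x y : ℕ → ℝ) :
    Up K v i (x + y) = Up K v i x + Up K v i y := by
  simp [Up, Finset.sum_add_distrib, mul_add]

theorem Up_smul (K : ℕ) (v : ℕ → ℝ) (i : ℕ) (c : ℝ) (x : ℕ → ℝ) :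
    Up K v i (c • x) = c * Up K v i x := by
  simp [Up, ← Finset.mul_sum, mul_left_comm]

theorem Uc_add (K : ℕ) (v : ℕ → ℝ) (i : ℕ) (x y : ℕ → ℝ) :
    Uc K v i (x + y) = Uc K v i x + Uc K v i y := by
  simp [Uc, Finset.sum_add_distrib, add_mul]

theorem Uc_smul (K : ℕ) (v : ℕ → ℝ) (i : ℕ) (c : ℝ) (x : ℕ → ℝ) :
    Uc K v i (c • x) = c * Uc K v i x := by
  simp [Uc, Finset.mul_sum, mul_assoc]

theorem Uc_nonneg {K : ℕ} {v x : ℕ → ℝ} {i : ℕ} (hi : i ∈ Finset.Icc 1 K)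
    (hmono : ∀ j ∈ Finset.Icc 1 K, ∀ k ∈ Finset.Icc 1 K, j < k → v j < v k)
    (hx : x ∈ simplex K) : 0 ≤ Uc K v i x := by
  refine Finset.sum_nonneg fun k hk => ?_
  have hk' := Finset.Icc_subset_Icc_left (Finset.mem_Icc.1 hi).1 hk
  refine mul_nonneg (hx.1 k hk') (sub_nonneg.2 ?_)
  rcases (Finset.mem_Icc.1 hk).1.eq_or_lt with rfl | hik
  · exact le_rfl
  · exact (hmono i hi k hk' hik).le

theorem Uc_add_Up_le {K : ℕ} {v x : ℕ → ℝ} {i : ℕ} (hi : i ∈ Finset.Icc 1 K)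
    (hv : ∀ k ∈ Finset.Icc 1 K, 0 < v k) (hx : x ∈ simplex K) :
    Uc K v i x + Up K v i x ≤ ∑ k ∈ Finset.Icc 1 K, x k * v k := by
  have h : Uc K v i x + Up K v i x = ∑ k ∈ Finset.Icc i K, x k * v k := by
    rw [Uc, Up, Finset.mul_sum, ← Finset.sum_add_distrib]
    exact Finset.sum_congr rfl fun k _ => by ring
  rw [h]
  exact Finset.sum_le_sum_of_subset_of_nonneg
    (Finset.Icc_subset_Icc_left (Finset.mem_Icc.1 hi).1)
    fun k hk _ => mul_nonneg (hx.1 k hk) (hv k hk).le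

/-- Two weighted points can be merged into one carrying the total weight, staying in a convex
set to which every point of positive weight belongs. -/
theorem exists_mem_add_smul_eq {E : Type*} [AddCommGroup E] [Module ℝ E] {C D : Set E}
    (hC : Convex ℝ C) (hD : Convex ℝ D) {c d : ℝ} (hc : 0 ≤ c) (hd : 0 ≤ d) {x y : E}
    (hx : x ∈ D) (hy : y ∈ D) (hxC : 0 < c → x ∈ C) (hyC : 0 < d → y ∈ C) :
    ∃ z ∈ D, (0 < c + d → z ∈ C) ∧ (c + d) • z = c • x + d • y := by
  rcases hc.eq_or_lt with rfl | hc'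
  · exact ⟨y, hy, by simpa using hyC, by simp⟩
  rcases hd.eq_or_lt with rfl | hd'
  · exact ⟨x, hx, by simpa using hxC, by simp⟩
  have hcd : c + d ≠ 0 := (add_pos hc' hd').ne'
  have h1 : c / (c + d) + d / (c + d) = 1 := by field_simp
  refine ⟨(c / (c + d)) • x + (d / (c + d)) • y, hD hx hy (by positivity) (by positivity) h1,
    fun _ => hC (hxC hc') (hyC hd') (by positivity) (by positivity) h1, ?_⟩
  rw [smul_add, smul_smul, smul_smul, mul_div_cancel₀ _ hcd, mul_div_cancel₀ _ hcd]

theorem convex_Sprime (K : ℕ) (v : ℕ → ℝ) (β : ℝ) (xstar : ℕ → ℝ) :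
    Convex ℝ (Sprime K v β xstar) := by
  rintro _ ⟨γ, x, hγ0, hγ1, hx, hxX, hxs, rfl⟩ _ ⟨δ, y, hδ0, hδ1, hy, hyX, hys, rfl⟩ a b ha hb hab
  have key : ∀ k, ∃ z : ℕ → ℝ, k ∈ Finset.Icc 1 K → z ∈ simplex K ∧
      (0 < a * γ k + b * δ k → z ∈ Xopt K v β k) ∧
      (a * γ k + b * δ k) • z = (a * γ k) • x k + (b * δ k) • y k := by
    intro k
    by_cases hk : k ∈ Finset.Icc 1 K
    · obtain ⟨z, hz⟩ := exists_mem_add_smul_eq (convex_Xopt K v β k) (convex_simplex K)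
        (mul_nonneg ha (hγ0 k hk)) (mul_nonneg hb (hδ0 k hk)) (hx k hk) (hy k hk)
        (fun h => hxX k hk (pos_of_mul_pos_right h ha))
        (fun h => hyX k hk (pos_of_mul_pos_right h hb))
      exact ⟨z, fun _ => hz⟩
    · exact ⟨0, fun h => absurd h hk⟩
  choose z hz using key
  refine ⟨fun k => a * γ k + b * δ k, z,
    fun k hk => add_nonneg (mul_nonneg ha (hγ0 k hk)) (mul_nonneg hb (hδ0 k hk)), ?_,
    fun k hk => (hz k hk).1, fun k hk => (hz k hk).2.1, fun j hj => ?_, ?_⟩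
  · rw [Finset.sum_add_distrib, ← Finset.mul_sum, ← Finset.mul_sum, hγ1, hδ1, mul_one, mul_one, hab]
  · have h : ∀ k ∈ Finset.Icc 1 K, (a * γ k + b * δ k) * z k j =
        a * (γ k * x k j) + b * (δ k * y k j) := fun k hk => by
      have := congrFun (hz k hk).2.2 j
      simp only [Pi.add_apply, Pi.smul_apply, smul_eq_mul] at this
      rw [this, mul_assoc, mul_assoc]
    rw [Finset.sum_congr rfl h, Finset.sum_add_distrib, ← Finset.mul_sum, ← Finset.mul_sum,
      hxs j hj, hys j hj, ← add_mul, hab, one_mul]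
  · have hc : ∀ k ∈ Finset.Icc 1 K, (a * γ k + b * δ k) * Uc K v k (z k) =
        a * (γ k * Uc K v k (x k)) + b * (δ k * Uc K v k (y k)) := fun k hk => by
      rw [← Uc_smul, (hz k hk).2.2, Uc_add, Uc_smul, Uc_smul, mul_assoc, mul_assoc]
    have hp : ∀ k ∈ Finset.Icc 1 K, (a * γ k + b * δ k) * Up K v k (z k) =
        a * (γ k * Up K v k (x k)) + b * (δ k * Up K v k (y k)) := fun k hk => by
      rw [← Up_smul, (hz k hk).2.2, Up_add, Up_smul, Up_smul, mul_assoc, mul_assoc]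
    simp only [Finset.sum_congr rfl hc, Finset.sum_congr rfl hp, Finset.sum_add_distrib,
      ← Finset.mul_sum, Prod.smul_mk, Prod.mk_add_mk, smul_eq_mul]

/-- `S'` is convex, lies to the right of the vertical axis, and lies
weakly below the maximum-total-surplus line `c + p ≤ Σ_k x*_k·v_k`. -/
theorem stmt_13 (K : ℕ) (hK : 1 ≤ K) (v xstar : ℕ → ℝ)
    (hv : ∀ k ∈ Finset.Icc 1 K, 0 < v k)
    (hmono : ∀ j ∈ Finset.Icc 1 K, ∀ k ∈ Finset.Icc 1 K, j < k → v j < v k)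
    (β : ℝ) (hβ0 : 0 ≤ β) (hβ1 : β < 1)
    (hxstar : xstar ∈ simplex K) :
    Convex ℝ (Sprime K v β xstar) ∧
      ∀ p ∈ Sprime K v β xstar,
        0 ≤ p.1 ∧ p.1 + p.2 ≤ ∑ k ∈ Finset.Icc 1 K, xstar k * v k := by
  refine ⟨convex_Sprime K v β xstar, ?_⟩
  rintro _ ⟨γ, x, hγ0, -, hx, -, hxs, rfl⟩
  refine ⟨Finset.sum_nonneg fun k hk => mul_nonneg (hγ0 k hk) (Uc_nonneg hk hmono (hx k hk)), ?_⟩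
  calc ∑ k ∈ Finset.Icc 1 K, γ k * Uc K v k (x k) + ∑ k ∈ Finset.Icc 1 K, γ k * Up K v k (x k)
      = ∑ k ∈ Finset.Icc 1 K, γ k * (Uc K v k (x k) + Up K v k (x k)) := by
        simp only [mul_add, Finset.sum_add_distrib]
    _ ≤ ∑ k ∈ Finset.Icc 1 K, γ k * ∑ j ∈ Finset.Icc 1 K, x k j * v j :=
        Finset.sum_le_sum fun k hk =>
          mul_le_mul_of_nonneg_left (Uc_add_Up_le hk hv (hx k hk)) (hγ0 k hk)
    _ = ∑ j ∈ Finset.Icc 1 K, (∑ k ∈ Finset.Icc 1 K, γ k * x k j) * v j := by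
        simp only [Finset.mul_sum, Finset.sum_mul, mul_assoc]
        exact Finset.sum_comm
    _ = ∑ j ∈ Finset.Icc 1 K, xstar j * v j :=
        Finset.sum_congr rfl fun j hj => by rw [hxs j hj]
end

section
/- The first-degree price discrimination point Q := (0, Σ_{k=1}^K x*_k·v_k) belongs to S' if and only if for every k with x*_k > 0 the point mass e_k (the market with k-th coordinate 1 and all other coordinates 0) belongs to X_k^β (equivalently, if and only if β ≤ β̄_k for every k in the support of x*). -/
/-- The price-`v k` revenue as a sum over all values. -/
lemma Up_eq_sum_ite {K k : ℕ} (hk : k ∈ Finset.Icc 1 K) (v x : ℕ → ℝ) :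
    Up K v k x = ∑ m ∈ Finset.Icc 1 K, x m * (if k ≤ m then v k else 0) := by
  have h : Finset.Icc k K = (Finset.Icc 1 K).filter (k ≤ ·) := by
    ext m
    simp only [Finset.mem_Icc, Finset.mem_filter] at hk ⊢
    omega
  rw [Up, h, Finset.sum_filter, Finset.mul_sum]
  refine Finset.sum_congr rfl fun m _ => ?_
  split_ifs <;> ring

/-- Membership in `Xopt` only depends on the coordinates `1, …, K`. -/
lemma Xopt_congr {K i : ℕ} (hi : i ∈ Finset.Icc 1 K) {v x y : ℕ → ℝ} {β : ℝ}
    (hxy : ∀ m ∈ Finset.Icc 1 K, x m = y m) (hx : x ∈ Xopt K v β i) : y ∈ Xopt K v β i := by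
  have hsum : ∀ j ∈ Finset.Icc 1 K, ∑ k ∈ Finset.Icc j K, x k = ∑ k ∈ Finset.Icc j K, y k :=
    fun j hj => Finset.sum_congr rfl fun m hm =>
      hxy m (Finset.Icc_subset_Icc_left (Finset.mem_Icc.1 hj).1 hm)
  obtain ⟨⟨hx0, hx1⟩, hopt⟩ := hx
  refine ⟨⟨fun k hk => hxy k hk ▸ hx0 k hk, ?_⟩, fun j hj => ?_⟩
  · rw [← hx1]
    exact (Finset.sum_congr rfl hxy).symm
  · rw [← hsum i hi, ← hsum j hj]
    exact hopt j hj

lemma pointMass_mem_simplex {K k : ℕ} (hk : k ∈ Finset.Icc 1 K) :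
    (fun m => if m = k then (1 : ℝ) else 0) ∈ simplex K := by
  refine ⟨fun m _ => ?_, ?_⟩
  · dsimp only
    split_ifs <;> norm_num
  · rw [Finset.sum_ite_eq', if_pos hk]

lemma Uc_pointMass (K k : ℕ) (v : ℕ → ℝ) :
    Uc K v k (fun m => if m = k then (1 : ℝ) else 0) = 0 := by
  refine Finset.sum_eq_zero fun m _ => ?_
  dsimp only
  split_ifs with h
  · simp [h]
  · simp

lemma Up_pointMass {K k : ℕ} (hk : k ∈ Finset.Icc 1 K) (v : ℕ → ℝ) :
    Up K v k (fun m => if m = k then (1 : ℝ) else 0) = v k := by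
  rw [Up, Finset.sum_ite_eq', if_pos (Finset.left_mem_Icc.2 (Finset.mem_Icc.1 hk).2), mul_one]

/-- If the producer extracts the whole welfare of the aggregate market, then the segment priced at
`v k` puts mass only on the value `v k`. -/
lemma mul_eq_zero_of_sum_Up_eq {K : ℕ} {v xstar γ : ℕ → ℝ} {xs : ℕ → ℕ → ℝ}
    (hv : ∀ k ∈ Finset.Icc 1 K, 0 < v k)
    (hmono : ∀ j ∈ Finset.Icc 1 K, ∀ k ∈ Finset.Icc 1 K, j < k → v j < v k)
    (hγ : ∀ k ∈ Finset.Icc 1 K, 0 ≤ γ k)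
    (hxs : ∀ k ∈ Finset.Icc 1 K, ∀ m ∈ Finset.Icc 1 K, 0 ≤ xs k m)
    (hagg : ∀ j ∈ Finset.Icc 1 K, ∑ k ∈ Finset.Icc 1 K, γ k * xs k j = xstar j)
    (hUp : ∑ k ∈ Finset.Icc 1 K, xstar k * v k = ∑ k ∈ Finset.Icc 1 K, γ k * Up K v k (xs k))
    {k m : ℕ} (hk : k ∈ Finset.Icc 1 K) (hm : m ∈ Finset.Icc 1 K) (hmk : m ≠ k) :
    γ k * xs k m = 0 := by
  have hpos : ∀ k ∈ Finset.Icc 1 K, ∀ m ∈ Finset.Icc 1 K, m ≠ k →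
      0 < v m - (if k ≤ m then v k else 0) := by
    intro k hk m hm hmk
    split_ifs with h
    · exact sub_pos.2 (hmono k hk m hm (lt_of_le_of_ne h hmk.symm))
    · simpa using hv m hm
  have hnonneg : ∀ k ∈ Finset.Icc 1 K, ∀ m ∈ Finset.Icc 1 K,
      0 ≤ γ k * xs k m * (v m - (if k ≤ m then v k else 0)) := by
    intro k hk m hm
    refine mul_nonneg (mul_nonneg (hγ k hk) (hxs k hk m hm)) ?_
    rcases eq_or_ne m k with rfl | h
    · simp
    · exact (hpos k hk m hm h).le
  have hzero : ∑ k ∈ Finset.Icc 1 K, ∑ m ∈ Finset.Icc 1 K,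
      γ k * xs k m * (v m - (if k ≤ m then v k else 0)) = 0 := by
    have hwelfare : ∑ k ∈ Finset.Icc 1 K, ∑ m ∈ Finset.Icc 1 K, γ k * xs k m * v m =
        ∑ k ∈ Finset.Icc 1 K, xstar k * v k := by
      rw [Finset.sum_comm]
      refine Finset.sum_congr rfl fun m hm => ?_
      rw [← Finset.sum_mul, hagg m hm]
    have hrevenue : ∑ k ∈ Finset.Icc 1 K, ∑ m ∈ Finset.Icc 1 K,
        γ k * xs k m * (if k ≤ m then v k else 0) =
        ∑ k ∈ Finset.Icc 1 K, γ k * Up K v k (xs k) := by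
      refine Finset.sum_congr rfl fun k hk => ?_
      rw [Up_eq_sum_ite hk, Finset.mul_sum]
      exact Finset.sum_congr rfl fun m _ => mul_assoc _ _ _
    simp only [mul_sub, Finset.sum_sub_distrib]
    rw [hwelfare, hrevenue, hUp, sub_self]
  have hk0 := (Finset.sum_eq_zero_iff_of_nonneg
    fun k hk => Finset.sum_nonneg (hnonneg k hk)).1 hzero k hk
  have hkm0 := (Finset.sum_eq_zero_iff_of_nonneg (hnonneg k hk)).1 hk0 m hm
  exact (mul_eq_zero.1 hkm0).resolve_right (hpos k hk m hm hmk).ne'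

/-- the first-degree price discrimination point
`Q = (0, Σ_k x*_k·v_k)` belongs to `S'` iff for every `k` in the support of `x*`
the point mass `e_k` belongs to `X_k^β`. -/
theorem stmt_14 (K : ℕ) (hK : 1 ≤ K) (v xstar : ℕ → ℝ)
    (hv : ∀ k ∈ Finset.Icc 1 K, 0 < v k)
    (hmono : ∀ j ∈ Finset.Icc 1 K, ∀ k ∈ Finset.Icc 1 K, j < k → v j < v k)
    (β : ℝ) (hβ0 : 0 ≤ β) (hβ1 : β < 1)
    (hxstar : xstar ∈ simplex K) :
    (((0 : ℝ), ∑ k ∈ Finset.Icc 1 K, xstar k * v k) ∈ Sprime K v β xstar) ↔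
      ∀ k ∈ Finset.Icc 1 K, 0 < xstar k →
        (fun m => if m = k then (1 : ℝ) else 0) ∈ Xopt K v β k := by
  constructor
  · rintro ⟨γ, xs, hγ, -, hxs, hopt, hagg, hQ⟩ k hk hxk
    have hoff : ∀ i ∈ Finset.Icc 1 K, ∀ m ∈ Finset.Icc 1 K, m ≠ i → γ i * xs i m = 0 :=
      fun i hi m hm hmi => mul_eq_zero_of_sum_Up_eq hv hmono hγ (fun k hk => (hxs k hk).1) hagg
        (congrArg Prod.snd hQ) hi hm hmi
    have hxstark : γ k * xs k k = xstar k := by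
      rw [← hagg k hk]
      exact (Finset.sum_eq_single_of_mem k hk fun i hi hik => hoff i hi k hk hik.symm).symm
    have hγk : 0 < γ k := by
      refine (hγ k hk).lt_of_ne fun h => ?_
      rw [← hxstark, ← h, zero_mul] at hxk
      exact hxk.false
    have hzero : ∀ m ∈ Finset.Icc 1 K, m ≠ k → xs k m = 0 := fun m hm hmk =>
      (mul_eq_zero.1 (hoff k hk m hm hmk)).resolve_left hγk.ne'
    refine Xopt_congr hk (fun m hm => ?_) (hopt k hk hγk)
    split_ifs with h
    · rw [h, ← (hxs k hk).2]
      exact (Finset.sum_eq_single_of_mem k hk hzero).symm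
    · exact hzero m hm h
  · intro h
    refine ⟨xstar, fun k m => if m = k then 1 else 0, hxstar.1, hxstar.2,
      fun k hk => pointMass_mem_simplex hk, h, fun j hj => ?_, Prod.ext ?_ ?_⟩
    · simp only [mul_ite, mul_one, mul_zero]
      rw [Finset.sum_ite_eq, if_pos hj]
    · simp only [Uc_pointMass, mul_zero, Finset.sum_const_zero]
    · dsimp only
      refine Finset.sum_congr rfl fun k hk => ?_
      rw [Up_pointMass hk]
end

section
/- Assume 0 < β < 1 and x*_k > 0 for every k ∈ {1,...,K}. Then: (a) there exists a point (c, p) ∈ S' with p ≤ max_{k ∈ {1,...,K}} U_p(v_k, x*); and (b) there exists a point (c, p) ∈ S' with p strictly less than max_{k} U_p(v_k, x*) if and only if there exists i ∈ {1,...,K} such that (K+1−i)·v_i > (K+1−j)·v_j for every j attaining max_{k} U_p(v_k, x*). (In words: the lowest producer utility in S' lies on or beneath the optimal uniform-pricing line of the non-private case, and strictly beneath it exactly when the optimal pricing in the fully private case differs from the non-private optimal uniform price.) -/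
/-- Revenue at price `v_i` in the uniform market, i.e. under full privacy. -/
noncomputable def privateRevenue (K : ℕ) (v : ℕ → ℝ) (i : ℕ) : ℝ :=
  v i * (((K : ℝ) + 1 - i) / K)

lemma mem_Xopt_iff {K : ℕ} {v : ℕ → ℝ} {β : ℝ} {i : ℕ} {x : ℕ → ℝ} :
    x ∈ Xopt K v β i ↔ x ∈ simplex K ∧ ∀ j ∈ Finset.Icc 1 K,
      (1 - β) * Up K v j x + β * privateRevenue K v j ≤
        (1 - β) * Up K v i x + β * privateRevenue K v i := by
  have h : ∀ k : ℕ, v k * ((1 - β) * ∑ l ∈ Finset.Icc k K, x l + β * ((K : ℝ) + 1 - k) / K) =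
      (1 - β) * Up K v k x + β * privateRevenue K v k := by
    intro k
    simp only [Up, privateRevenue]
    ring
  simp only [Xopt, Set.mem_ofPred_eq, ge_iff_le, h]

lemma Up_linear_comb (K : ℕ) (v : ℕ → ℝ) (k : ℕ) (a b : ℝ) (x y : ℕ → ℝ) :
    Up K v k (fun n => a * x n + b * y n) = a * Up K v k x + b * Up K v k y := by
  simp only [Up, Finset.sum_add_distrib, ← Finset.mul_sum]
  ring

lemma Up_uniform {K k : ℕ} (v : ℕ → ℝ) (hk : k ∈ Finset.Icc 1 K) :
    Up K v k (fun _ => 1 / (K : ℝ)) = privateRevenue K v k := by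
  have hkK : k ≤ K + 1 := by have := (Finset.mem_Icc.mp hk).2; omega
  simp only [Up, privateRevenue, Finset.sum_const, Nat.card_Icc, nsmul_eq_mul, Nat.cast_sub hkK]
  push_cast
  ring

lemma sum_linear_comb (s : Finset ℕ) (a b : ℝ) (x y : ℕ → ℝ) :
    ∑ n ∈ s, (a * x n + b * y n) = a * ∑ n ∈ s, x n + b * ∑ n ∈ s, y n := by
  simp only [Finset.sum_add_distrib, ← Finset.mul_sum]

lemma uniform_mem_simplex {K : ℕ} (hK : 1 ≤ K) : (fun _ => 1 / (K : ℝ)) ∈ simplex K := by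
  have : (K : ℝ) ≠ 0 := by exact_mod_cast (by omega : K ≠ 0)
  refine ⟨fun _ _ => by positivity, ?_⟩
  simp [this]

lemma le_one_of_mem_simplex {K k : ℕ} {x : ℕ → ℝ} (hx : x ∈ simplex K)
    (hk : k ∈ Finset.Icc 1 K) : x k ≤ 1 :=
  hx.2 ▸ Finset.single_le_sum (f := x) hx.1 hk

lemma exists_mem_Sprime_of_mem_Xopt {K : ℕ} {v : ℕ → ℝ} {β : ℝ} {x : ℕ → ℝ} {i : ℕ}
    (hi : i ∈ Finset.Icc 1 K) (hx : x ∈ Xopt K v β i) :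
    ∃ p ∈ Sprime K v β x, p.2 = Up K v i x := by
  have hsum : ∀ f : ℕ → ℝ, ∑ k ∈ Finset.Icc 1 K, (Pi.single i 1 : ℕ → ℝ) k * f k = f i := by
    intro f
    simp only [Pi.single_apply, ite_mul, one_mul, zero_mul, Finset.sum_ite_eq', hi, if_true]
  refine ⟨_, ⟨Pi.single i 1, fun _ => x, ?_, ?_, fun _ _ => hx.1, ?_, ?_, rfl⟩, ?_⟩
  · intro k _
    simp only [Pi.single_apply]
    split_ifs <;> norm_num
  · simpa using hsum fun _ => 1
  · intro k _ hk
    by_cases h : k = i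
    · rwa [h]
    · simp [h] at hk
  · exact fun j _ => hsum fun _ => x j
  · exact hsum fun k => Up K v k x

lemma exists_mem_Sprime_of_two_segments {K : ℕ} {v : ℕ → ℝ} {β : ℝ} {x y z : ℕ → ℝ} {i j : ℕ}
    {ε : ℝ} (hi : i ∈ Finset.Icc 1 K) (hj : j ∈ Finset.Icc 1 K) (hij : i ≠ j)
    (hε0 : 0 ≤ ε) (hε1 : ε ≤ 1) (hy : y ∈ Xopt K v β i) (hz : z ∈ Xopt K v β j)
    (hx : ∀ k ∈ Finset.Icc 1 K, ε * y k + (1 - ε) * z k = x k) :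
    ∃ p ∈ Sprime K v β x, p.2 = ε * Up K v i y + (1 - ε) * Up K v j z := by
  set γ : ℕ → ℝ := Pi.single i ε + Pi.single j (1 - ε) with hγ
  set xs : ℕ → ℕ → ℝ := fun k => if k = i then y else z with hxs
  have hxi : xs i = y := if_pos rfl
  have hxj : xs j = z := if_neg hij.symm
  have hsum : ∀ f : ℕ → ℝ, ∑ k ∈ Finset.Icc 1 K, γ k * f k = ε * f i + (1 - ε) * f j := by
    intro f
    simp only [hγ, Pi.add_apply, Pi.single_apply, add_mul, Finset.sum_add_distrib, ite_mul,
      zero_mul, Finset.sum_ite_eq', hi, hj, if_true]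
  refine ⟨_, ⟨γ, xs, ?_, ?_, ?_, ?_, ?_, rfl⟩, ?_⟩
  · intro k _
    simp only [hγ, Pi.add_apply, Pi.single_apply]
    split_ifs <;> linarith
  · simpa using hsum fun _ => 1
  · intro k _
    simp only [hxs]
    split_ifs
    exacts [hy.1, hz.1]
  · intro k _ hk
    by_cases h : k = i
    · rwa [h, hxi]
    · by_cases h' : k = j
      · rwa [h', hxj]
      · simp [hγ, h, h'] at hk
  · intro l hl
    rw [hsum fun k => xs k l, hxi, hxj, hx l hl]
  · simp only [hsum, hxi, hxj]

lemma le_snd_of_mem_Sprime {K : ℕ} {v : ℕ → ℝ} {β : ℝ} {x : ℕ → ℝ} {j : ℕ}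
    (hj : j ∈ Finset.Icc 1 K) (hβ0 : 0 ≤ β) (hβ1 : β < 1)
    (hmax : ∀ k ∈ Finset.Icc 1 K, privateRevenue K v k ≤ privateRevenue K v j)
    {p : ℝ × ℝ} (hp : p ∈ Sprime K v β x) : Up K v j x ≤ p.2 := by
  obtain ⟨γ, xs, hγ0, -, -, hopt, hx, rfl⟩ := hp
  have hUx : Up K v j x = ∑ k ∈ Finset.Icc 1 K, γ k * Up K v j (xs k) := by
    have hsub : ∀ l ∈ Finset.Icc j K, x l = ∑ k ∈ Finset.Icc 1 K, γ k * xs k l := by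
      intro l hl
      refine (hx l ?_).symm
      rw [Finset.mem_Icc] at hl hj ⊢
      omega
    simp only [Up]
    rw [Finset.sum_congr rfl hsub, Finset.sum_comm, Finset.mul_sum]
    refine Finset.sum_congr rfl fun k _ => ?_
    rw [← Finset.mul_sum]
    ring
  rw [hUx]
  refine Finset.sum_le_sum fun k hk => ?_
  rcases (hγ0 k hk).eq_or_lt with h | h
  · simp [← h]
  · refine mul_le_mul_of_nonneg_left ?_ h.le
    have h1 := (mem_Xopt_iff.mp (hopt k hk h)).2 j hj
    have h2 := mul_le_mul_of_nonneg_left (hmax k hk) hβ0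
    exact le_of_mul_le_mul_left (by linarith) (sub_pos.mpr hβ1)

/-- Moving from `x` towards the uniform market there is a market where some price `v_i` is
optimal and ties with `v_j`, while its own revenue is strictly smaller. -/
lemma exists_tie_towards_uniform {K : ℕ} (hK : 1 ≤ K) {v : ℕ → ℝ} {β : ℝ} {x : ℕ → ℝ} {j : ℕ}
    (hj : j ∈ Finset.Icc 1 K) (hβ0 : 0 < β) (hβ1 : β < 1) (hxj : x ∈ Xopt K v β j)
    (hU : ∀ k ∈ Finset.Icc 1 K, Up K v k x ≤ Up K v j x)
    (hex : ∃ i ∈ Finset.Icc 1 K, privateRevenue K v j < privateRevenue K v i) :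
    ∃ i ∈ Finset.Icc 1 K, ∃ t, 0 ≤ t ∧ t ≤ 1 ∧
      (fun n => (1 - t) * x n + t * (1 / (K : ℝ))) ∈ Xopt K v β i ∧
      Up K v i (fun n => (1 - t) * x n + t * (1 / (K : ℝ))) <
        Up K v j (fun n => (1 - t) * x n + t * (1 / (K : ℝ))) := by
  obtain ⟨hxs, hopt⟩ := mem_Xopt_iff.mp hxj
  set U : ℕ → ℝ := fun k => Up K v k x with hUdef
  set a : ℕ → ℝ := privateRevenue K v with ha
  have hβ' : 0 < 1 - β := sub_pos.mpr hβ1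
  obtain ⟨i, hiS, hmin⟩ := Finset.exists_min_image
    ((Finset.Icc 1 K).filter fun i => a j < a i) (fun i => (U j - U i) / (a i - a j))
    (by obtain ⟨i, hi, h⟩ := hex; exact ⟨i, Finset.mem_filter.mpr ⟨hi, h⟩⟩)
  obtain ⟨hi, hai⟩ := Finset.mem_filter.mp hiS
  set r := (U j - U i) / (a i - a j) with hr
  have hr_eq : r * (a i - a j) = U j - U i := div_mul_cancel₀ _ (sub_pos.mpr hai).ne'
  have hr_lb : β / (1 - β) ≤ r := by
    rw [hr, div_le_div_iff₀ hβ' (sub_pos.mpr hai)]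
    have := hopt i hi
    simp only [hUdef]
    linarith
  have hr0 : 0 < r := lt_of_lt_of_le (by positivity) hr_lb
  have hbr : β ≤ r * (1 - β) := (div_le_iff₀ hβ').mp hr_lb
  have hbest : ∀ k ∈ Finset.Icc 1 K, U k + r * a k ≤ U i + r * a i := by
    intro k hk
    have hkU : U k ≤ U j := hU k hk
    rcases le_or_gt (a k) (a j) with h | h
    · nlinarith [mul_le_mul_of_nonneg_left h hr0.le]
    · have h1 := hmin k (Finset.mem_filter.mpr ⟨hk, h⟩)
      rw [le_div_iff₀ (sub_pos.mpr h)] at h1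
      linarith
  -- the mixture with weight `t` has perturbed revenues proportional to `U k + r * a k`
  set c := 1 / ((1 + r) * (1 - β)) with hc
  have hc0 : 0 < c := by positivity
  have hc_eq : c * ((1 + r) * (1 - β)) = 1 := one_div_mul_cancel (by positivity)
  have hc1 : c ≤ 1 := by
    rw [hc, div_le_one (by positivity)]
    linarith
  have hUy : ∀ k ∈ Finset.Icc 1 K, Up K v k (fun n => (1 - (1 - c)) * x n + (1 - c) * (1 / (K : ℝ)))
      = c * U k + (1 - c) * a k := by
    intro k hk
    rw [Up_linear_comb K v k (1 - (1 - c)) (1 - c) x (fun _ => 1 / (K : ℝ)), Up_uniform v hk]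
    ring
  have hval : ∀ k, (1 - β) * (c * U k + (1 - c) * a k) + β * a k
      = c * (1 - β) * (U k + r * a k) := by
    intro k
    linear_combination (-a k) * hc_eq
  refine ⟨i, hi, 1 - c, by linarith, by linarith, mem_Xopt_iff.mpr ⟨⟨?_, ?_⟩, ?_⟩, ?_⟩
  · intro k hk
    have h1 := hxs.1 k hk
    have : 0 ≤ 1 - c := by linarith
    have : 0 ≤ 1 - (1 - c) := by linarith
    positivity
  · rw [sum_linear_comb _ _ _ x (fun _ => 1 / (K : ℝ)), hxs.2, (uniform_mem_simplex hK).2]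
    ring
  · intro k hk
    rw [hUy k hk, hUy i hi, hval, hval]
    exact mul_le_mul_of_nonneg_left (hbest k hk) (by positivity)
  · rw [hUy i hi, hUy j hj]
    have hi' := hval i
    have hj' := hval j
    have htie : U i + r * a i = U j + r * a j := by linarith
    rw [htie, ← hj'] at hi'
    have := mul_lt_mul_of_pos_left hai hβ0
    exact lt_of_mul_lt_mul_left (by linarith) hβ'.le

/-- Moving from `x` slightly away from the uniform market keeps `v_j` optimal. -/
lemma residual_mem_Xopt {K : ℕ} (hK : 1 ≤ K) {v : ℕ → ℝ} {β : ℝ} {x : ℕ → ℝ} {j : ℕ} {t ε : ℝ}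
    (hβ0 : 0 < β) (hβ1 : β < 1) (hxj : x ∈ Xopt K v β j)
    (hU : ∀ k ∈ Finset.Icc 1 K, Up K v k x ≤ Up K v j x) (hj : j ∈ Finset.Icc 1 K)
    (ht0 : 0 ≤ t) (ht1 : t ≤ 1) (hε0 : 0 < ε) (hεβ : ε ≤ β)
    (hεx : ∀ k ∈ Finset.Icc 1 K, ε ≤ x k) :
    (fun n => ((1 - ε * (1 - t)) / (1 - ε)) * x n + (-(ε * t / (1 - ε))) * (1 / (K : ℝ))) ∈
      Xopt K v β j := by
  obtain ⟨hxs, hopt⟩ := mem_Xopt_iff.mp hxj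
  have hε1 : 0 < 1 - ε := by linarith
  have hβ' : 0 < 1 - β := sub_pos.mpr hβ1
  set d := ε * t / (1 - ε) with hd
  have hd0 : 0 ≤ d := by positivity
  have hA : (1 - ε * (1 - t)) / (1 - ε) = 1 + d := by
    rw [hd]
    field_simp
    ring
  have hdB : (1 - β) * d ≤ β := by
    rw [hd, ← mul_div_assoc, div_le_iff₀ hε1]
    nlinarith [mul_le_mul_of_nonneg_left ht1 (mul_pos hβ' hε0).le]
  rw [hA]
  refine mem_Xopt_iff.mpr ⟨⟨?_, ?_⟩, ?_⟩
  · intro k hk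
    have hu : (1 : ℝ) / K ≤ 1 := le_one_of_mem_simplex (uniform_mem_simplex hK) hk
    have hdε : d * (1 - ε) ≤ ε := by
      rw [hd, div_mul_cancel₀ _ hε1.ne']
      nlinarith
    have h1 : ε * (1 + d) ≤ (1 + d) * x k := by nlinarith [hεx k hk]
    have h2 : d * (1 / (K : ℝ)) ≤ d := by nlinarith
    simp only
    nlinarith
  · rw [sum_linear_comb _ _ _ x (fun _ => 1 / (K : ℝ)), hxs.2, (uniform_mem_simplex hK).2]
    ring
  · intro k hk
    rw [Up_linear_comb K v k _ _ x (fun _ => 1 / (K : ℝ)),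
      Up_linear_comb K v j _ _ x (fun _ => 1 / (K : ℝ)), Up_uniform v hk, Up_uniform v hj]
    have hs : 0 ≤ 1 - (1 - β) * d / β := by
      rw [sub_nonneg, div_le_one hβ0]
      exact hdB
    have h1 := mul_le_mul_of_nonneg_left (hopt k hk) hs
    have h2 := mul_le_mul_of_nonneg_left (hU k hk)
      (by positivity : 0 ≤ (1 - β) * d * (1 / β))
    have key : ∀ u w : ℝ, (1 - β) * ((1 + d) * u + -d * w) + β * w =
        (1 - (1 - β) * d / β) * ((1 - β) * u + β * w) + (1 - β) * d * (1 / β) * u := by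
      intro u w
      field_simp
      ring
    rw [key, key]
    linarith

/-- Proposition on the minimum of `S'`: assume `0 < β < 1` and
`x*_k > 0` for all `k`.  (a) Some point of `S'` has producer utility at most the
optimal uniform-pricing revenue `max_k U_p(v_k, x*)`; (b) some point of `S'` has
producer utility strictly below it iff there exists `i` with
`(K+1−i)·v_i > (K+1−j)·v_j` for every `j` attaining `max_k U_p(v_k, x*)`. -/
theorem stmt_15 (K : ℕ) (hK : 1 ≤ K) (v xstar : ℕ → ℝ)
    (hv : ∀ k ∈ Finset.Icc 1 K, 0 < v k)
    (hmono : ∀ j ∈ Finset.Icc 1 K, ∀ k ∈ Finset.Icc 1 K, j < k → v j < v k)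
    (β : ℝ) (hβ0 : 0 ≤ β) (hβ1 : β < 1)
    (hxstar : xstar ∈ simplex K)
    (hne : (Finset.Icc 1 K).Nonempty)
    (hβpos : 0 < β)
    (hxpos : ∀ k ∈ Finset.Icc 1 K, 0 < xstar k) :
    (∃ p ∈ Sprime K v β xstar,
        p.2 ≤ (Finset.Icc 1 K).sup' hne fun k => Up K v k xstar) ∧
    ((∃ p ∈ Sprime K v β xstar,
        p.2 < (Finset.Icc 1 K).sup' hne fun k => Up K v k xstar) ↔
      ∃ i ∈ Finset.Icc 1 K, ∀ j ∈ Finset.Icc 1 K,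
        Up K v j xstar = ((Finset.Icc 1 K).sup' hne fun k => Up K v k xstar) →
          ((K : ℝ) + 1 - j) * v j < ((K : ℝ) + 1 - i) * v i) := by
  set M := (Finset.Icc 1 K).sup' hne fun k => Up K v k xstar with hM
  have hle : ∀ k ∈ Finset.Icc 1 K, Up K v k xstar ≤ M := fun k hk =>
    Finset.le_sup' (fun k => Up K v k xstar) hk
  obtain ⟨j, hj, hjmax⟩ := Finset.exists_max_image (Finset.Icc 1 K)
    (fun k => (1 - β) * Up K v k xstar + β * privateRevenue K v k) hne
  have hxj : xstar ∈ Xopt K v β j := mem_Xopt_iff.mpr ⟨hxstar, hjmax⟩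
  have hK0 : (0 : ℝ) < K := by exact_mod_cast hK
  have hrev : ∀ i j : ℕ, ((K : ℝ) + 1 - j) * v j < ((K : ℝ) + 1 - i) * v i ↔
      privateRevenue K v j < privateRevenue K v i := by
    intro i j
    simp only [privateRevenue, ← mul_div_assoc, div_lt_div_iff_of_pos_right hK0]
    rw [mul_comm (v j), mul_comm (v i)]
  simp only [hrev]
  obtain ⟨p, hp, hpj⟩ := exists_mem_Sprime_of_mem_Xopt hj hxj
  refine ⟨⟨p, hp, hpj ▸ hle j hj⟩, ?_, ?_⟩
  · rintro ⟨q, hq, hqM⟩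
    obtain ⟨i, hi, himax⟩ := Finset.exists_max_image (Finset.Icc 1 K) (privateRevenue K v) hne
    refine ⟨i, hi, fun l hl hlM => ?_⟩
    by_contra! h
    have := le_snd_of_mem_Sprime hl hβ0 hβ1 (fun k hk => (himax k hk).trans h) hq
    linarith
  · rintro ⟨i₀, hi₀, hlt⟩
    rcases (hle j hj).lt_or_eq with h | h
    · exact ⟨p, hp, hpj ▸ h⟩
    have hU : ∀ k ∈ Finset.Icc 1 K, Up K v k xstar ≤ Up K v j xstar := by
      simpa only [h] using hle
    obtain ⟨i, hi, t, ht0, ht1, hy, hyU⟩ := exists_tie_towards_uniform hK hj hβpos hβ1 hxj hU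
      ⟨i₀, hi₀, hlt j hj h⟩
    obtain ⟨m, hm, hmin⟩ := Finset.exists_min_image (Finset.Icc 1 K) xstar hne
    have hε0 : 0 < min β (xstar m) := lt_min hβpos (hxpos m hm)
    have hεβ : min β (xstar m) ≤ β := min_le_left _ _
    have hεx : ∀ k ∈ Finset.Icc 1 K, min β (xstar m) ≤ xstar k := fun k hk =>
      (min_le_right _ _).trans (hmin k hk)
    set ε := min β (xstar m)
    have hz := residual_mem_Xopt hK hβpos hβ1 hxj hU hj ht0 ht1 hε0 hεβ hεx
    have hε1 : 1 - ε ≠ 0 := by linarith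
    have hij : i ≠ j := by
      rintro rfl
      exact lt_irrefl _ hyU
    obtain ⟨q, hq, hqU⟩ := exists_mem_Sprime_of_two_segments (x := xstar) hi hj hij hε0.le
      (by linarith) hy hz (fun k _ => by field_simp; ring)
    refine ⟨q, hq, ?_⟩
    have hsplit : ε * Up K v j (fun n => (1 - t) * xstar n + t * (1 / (K : ℝ))) + (1 - ε) *
        Up K v j (fun n => ((1 - ε * (1 - t)) / (1 - ε)) * xstar n +
          (-(ε * t / (1 - ε))) * (1 / (K : ℝ))) = Up K v j xstar := by
      rw [← Up_linear_comb]
      congr 1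
      funext n
      field_simp
      ring
    rw [hqU, ← h, ← hsplit]
    gcongr
end

section
/- Assume 0 < β < 1 and x*_k > 0 for every k. Then for every probability weight vector (p_1,...,p_K) (p_k ≥ 0, Σ_k p_k = 1), β·Σ_{k=1}^K p_k·U_p(v_k, x*) + (1−β)·inf{ p : ∃ c, (c, p) ∈ S' } ≤ max_{k ∈ {1,...,K}} U_p(v_k, x*). In particular, the minimum producer utility across all segmentations under the privacy mechanism is weakly smaller than the non-private minimum, which equals the optimal uniform-pricing revenue max_k U_p(v_k, x*). -/
/-- Producer utility is nonnegative on the simplex. -/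
theorem Up_nonneg {K : ℕ} {v : ℕ → ℝ} (hv : ∀ k ∈ Finset.Icc 1 K, 0 < v k) {x : ℕ → ℝ}
    (hx : x ∈ simplex K) {i : ℕ} (hi : i ∈ Finset.Icc 1 K) : 0 ≤ Up K v i x :=
  mul_nonneg (hv i hi).le <| Finset.sum_nonneg fun k hk =>
    hx.1 k <| Finset.Icc_subset_Icc_left (Finset.mem_Icc.mp hi).1 hk

/-- Some price is optimal for any given market under the privacy mechanism. -/
theorem exists_mem_Xopt {K : ℕ} (hne : (Finset.Icc 1 K).Nonempty) (v : ℕ → ℝ) (β : ℝ)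
    {x : ℕ → ℝ} (hx : x ∈ simplex K) : ∃ i ∈ Finset.Icc 1 K, x ∈ Xopt K v β i := by
  obtain ⟨i, hi, hmax⟩ := Finset.exists_max_image (Finset.Icc 1 K)
    (fun j => v j * ((1 - β) * ∑ k ∈ Finset.Icc j K, x k + β * ((K : ℝ) + 1 - j) / K)) hne
  exact ⟨i, hi, hx, hmax⟩

/-- Leaving the market unsegmented and charging an optimal price is achievable. -/
theorem mem_Sprime_of_mem_Xopt {K : ℕ} {v : ℕ → ℝ} {β : ℝ} {x : ℕ → ℝ} {i : ℕ}
    (hi : i ∈ Finset.Icc 1 K) (hx : x ∈ Xopt K v β i) :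
    (Uc K v i x, Up K v i x) ∈ Sprime K v β x := by
  refine ⟨fun k => if k = i then 1 else 0, fun _ => x, fun k _ => ?_, ?_, fun _ _ => hx.1,
    fun k _ hk => ?_, fun j _ => ?_, ?_⟩
  · dsimp only
    split_ifs <;> norm_num
  · rw [Finset.sum_ite_eq', if_pos hi]
  · obtain rfl : k = i := by
      by_contra h
      simp [h] at hk
    exact hx
  · simp only [ite_mul, one_mul, zero_mul, Finset.sum_ite_eq', if_pos hi]
  · simp only [ite_mul, one_mul, zero_mul, Finset.sum_ite_eq', if_pos hi]

/-- Producer utilities of achievable pairs are bounded below. -/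
theorem bddBelow_producer_Sprime {K : ℕ} {v : ℕ → ℝ} (hv : ∀ k ∈ Finset.Icc 1 K, 0 < v k)
    (β : ℝ) (x : ℕ → ℝ) : BddBelow {q : ℝ | ∃ c : ℝ, (c, q) ∈ Sprime K v β x} := by
  refine ⟨0, ?_⟩
  rintro q ⟨c, γ, xs, hγ, -, hxs, -, -, heq⟩
  rw [(Prod.mk.inj heq).2]
  exact Finset.sum_nonneg fun k hk => mul_nonneg (hγ k hk) (Up_nonneg hv (hxs k hk) hk)

/-- Corollary: privacy weakly lowers the minimum producer utility:
for any probability weights `(p_k)`,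
`β·Σ_k p_k·U_p(v_k, x*) + (1−β)·inf{p : (c,p) ∈ S'} ≤ max_k U_p(v_k, x*)`. -/
theorem stmt_16 (K : ℕ) (hK : 1 ≤ K) (v xstar : ℕ → ℝ)
    (hv : ∀ k ∈ Finset.Icc 1 K, 0 < v k)
    (hmono : ∀ j ∈ Finset.Icc 1 K, ∀ k ∈ Finset.Icc 1 K, j < k → v j < v k)
    (β : ℝ) (hβ0 : 0 ≤ β) (hβ1 : β < 1)
    (hxstar : xstar ∈ simplex K)
    (hne : (Finset.Icc 1 K).Nonempty)
    (hβpos : 0 < β)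
    (hxpos : ∀ k ∈ Finset.Icc 1 K, 0 < xstar k) :
    ∀ p : ℕ → ℝ, (∀ k ∈ Finset.Icc 1 K, 0 ≤ p k) →
      (∑ k ∈ Finset.Icc 1 K, p k) = 1 →
      β * ∑ k ∈ Finset.Icc 1 K, p k * Up K v k xstar +
          (1 - β) * sInf {q : ℝ | ∃ c : ℝ, (c, q) ∈ Sprime K v β xstar} ≤
        (Finset.Icc 1 K).sup' hne fun k => Up K v k xstar := by
  intro p hp hp1
  set M := (Finset.Icc 1 K).sup' hne fun k => Up K v k xstar with hM
  have hle : ∀ k ∈ Finset.Icc 1 K, Up K v k xstar ≤ M := fun k hk =>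
    Finset.le_sup' (fun k => Up K v k xstar) hk
  have havg : ∑ k ∈ Finset.Icc 1 K, p k * Up K v k xstar ≤ M :=
    calc ∑ k ∈ Finset.Icc 1 K, p k * Up K v k xstar
        ≤ ∑ k ∈ Finset.Icc 1 K, p k * M :=
          Finset.sum_le_sum fun k hk => mul_le_mul_of_nonneg_left (hle k hk) (hp k hk)
      _ = M := by rw [← Finset.sum_mul, hp1, one_mul]
  obtain ⟨i, hi, hopt⟩ := exists_mem_Xopt hne v β hxstar
  have hinf : sInf {q : ℝ | ∃ c : ℝ, (c, q) ∈ Sprime K v β xstar} ≤ M :=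
    (csInf_le (bddBelow_producer_Sprime hv β xstar)
      ⟨_, mem_Sprime_of_mem_Xopt hi hopt⟩).trans (hle i hi)
  calc _ ≤ β * M + (1 - β) * M := add_le_add (mul_le_mul_of_nonneg_left havg hβ0)
        (mul_le_mul_of_nonneg_left hinf (sub_nonneg.mpr hβ1.le))
    _ = M := by ring
end

section
/- Assume K ≥ 2 and that X_K^β is empty (equivalently β > β̄_K, so that the highest value v_K is never an optimal price under the privacy mechanism). Then every point (c, p) ∈ S' satisfies c ≥ x*_K·(v_K − v_{K−1}); that is, S' is distanced from the vertical axis by at least x*_K·(v_K − v_{K−1}). -/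
/-- A market priced at an index `i < K` yields consumer utility at least `x_K · (v_K − v_{K−1})`. -/
theorem mul_sub_le_Uc {K : ℕ} {v x : ℕ → ℝ} {i : ℕ}
    (hv : MonotoneOn v (Set.Icc 1 K)) (hx : x ∈ simplex K) (hi : 1 ≤ i) (hiK : i < K) :
    x K * (v K - v (K - 1)) ≤ Uc K v i x := by
  have hterm : ∀ k ∈ Finset.Icc i K, 0 ≤ x k * (v k - v i) := by
    intro k hk
    rw [Finset.mem_Icc] at hk
    exact mul_nonneg (hx.1 k (Finset.mem_Icc.2 ⟨by omega, hk.2⟩))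
      (sub_nonneg.2 (hv ⟨hi, hiK.le⟩ ⟨by omega, hk.2⟩ hk.1))
  calc x K * (v K - v (K - 1)) ≤ x K * (v K - v i) :=
        mul_le_mul_of_nonneg_left
          (sub_le_sub_left (hv ⟨hi, hiK.le⟩ ⟨by omega, by omega⟩ (by omega)) _)
          (hx.1 K (Finset.mem_Icc.2 ⟨by omega, le_rfl⟩))
    _ ≤ Uc K v i x :=
        Finset.single_le_sum (f := fun k => x k * (v k - v i)) hterm
          (Finset.mem_Icc.2 ⟨hiK.le, le_rfl⟩)

/-- Fact 2: if `K ≥ 2` and `X_K^β = ∅` (the highest value is never an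
optimal price), then every `(c, p) ∈ S'` has `c ≥ x*_K·(v_K − v_{K−1})`. -/
theorem stmt_17 (K : ℕ) (hK : 2 ≤ K) (v xstar : ℕ → ℝ)
    (hv : ∀ k ∈ Finset.Icc 1 K, 0 < v k)
    (hmono : ∀ j ∈ Finset.Icc 1 K, ∀ k ∈ Finset.Icc 1 K, j < k → v j < v k)
    (β : ℝ) (hβ0 : 0 ≤ β) (hβ1 : β < 1)
    (hxstar : xstar ∈ simplex K)
    (hempty : Xopt K v β K = ∅) :
    ∀ p ∈ Sprime K v β xstar, xstar K * (v K - v (K - 1)) ≤ p.1 := by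
  rintro _ ⟨γ, xs, hγ, -, hxs, hopt, hagg, rfl⟩
  have hKmem : K ∈ Finset.Icc 1 K := Finset.mem_Icc.2 ⟨by omega, le_rfl⟩
  have hγK : γ K = 0 := by
    refine ((hγ K hKmem).eq_or_lt.resolve_right fun h => ?_).symm
    simpa [hempty] using hopt K hKmem h
  have hvmono : MonotoneOn v (Set.Icc 1 K) := by
    intro a ha b hb hab
    rcases hab.eq_or_lt with rfl | h
    · exact le_rfl
    · exact (hmono a (Finset.mem_Icc.2 ha) b (Finset.mem_Icc.2 hb) h).le
  rw [← hagg K hKmem, Finset.sum_mul]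
  refine Finset.sum_le_sum fun k hk => ?_
  obtain ⟨hk1, hkK⟩ := Finset.mem_Icc.1 hk
  rcases hkK.eq_or_lt with rfl | hlt
  · simp [hγK]
  · rw [mul_assoc]
    exact mul_le_mul_of_nonneg_left (mul_sub_le_Uc hvmono (hxs k hk) hk1 hlt) (hγ k hk)
end
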